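/- arXiv:1807.04310 — 3 statements merged into one kernel-verified Lean document; each statement's English description precedes it below -/
import Mathlib

section
/- For all integers n ≥ 1, the partition function satisfies p(n) < (5.5/n)·exp(π√(2n/3)). -/
open Real

noncomputable def kG (i : ℕ) : PowerSeries ℕ := PowerSeries.mk (fun m => if (i+1) ∣ m then 1 else 0)
noncomputable def kP (N : ℕ) : PowerSeries ℕ := ∏ i ∈ Finset.range N, kG i

open scoped PowerSeries.WithPiTopology in
lemma kP_coeff (n : ℕ) : ∀ᶠ N in Filter.atTop, (kP N).coeff n = Fintype.card (Nat.Partition n) := by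
  have h := Nat.Partition.hasProd_powerSeriesMk_card_restricted ℕ (fun _ => True)
  have h2 := h.tendsto_prod_nat
  rw [PowerSeries.WithPiTopology.tendsto_iff_coeff_tendsto] at h2
  have h3 := h2 n
  rw [nhds_discrete, Filter.tendsto_pure] at h3
  filter_upwards [h3] with N hN
  have e : (Nat.Partition.restricted n (fun _ => True)) = Finset.univ := by
    ext p; simp [Nat.Partition.restricted]
  simp only [PowerSeries.coeff_mk, e, Finset.card_univ, Nat.cast_id, if_true] at hN
  rw [← hN, kP]
  congr 1
  refine Finset.prod_congr rfl fun i _ => ?_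
  have hs : Summable fun j : ℕ => (PowerSeries.X : PowerSeries ℕ) ^ ((i+1) * j) := by
    apply PowerSeries.WithPiTopology.summable_of_tendsto_order_atTop_nhds_top
    refine ENat.tendsto_nhds_top_iff_natCast_lt.mpr (fun n ↦ Filter.eventually_atTop.mpr ⟨n+1, ?_⟩)
    intro m hm
    rw [PowerSeries.order_X_pow]
    norm_cast
    nlinarith
  ext m
  rw [hs.map_tsum _ (PowerSeries.WithPiTopology.continuous_coeff _ _)]
  simp only [kG, PowerSeries.coeff_mk, PowerSeries.coeff_X_pow]
  split_ifs with hd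
  · obtain ⟨c, rfl⟩ := hd
    rw [tsum_eq_single c]
    · simp
    · intro b hb
      simp; omega
  · symm
    convert tsum_zero with j
    rw [if_neg]
    rintro rfl
    exact hd ⟨j, rfl⟩

lemma kG_hasSum (i : ℕ) (z : ℂ) (hz : ‖z‖ < 1) :
    Summable (fun m => ‖((kG i).coeff m : ℂ) * z ^ m‖) ∧
    HasSum (fun m => ((kG i).coeff m : ℂ) * z ^ m) (1 - z ^ (i+1))⁻¹ := by
  have inj : Function.Injective (fun j : ℕ => (i+1) * j) := fun a b h => by
    simpa using h
  have hlt : ‖z ^ (i+1)‖ < 1 := by rw [norm_pow]; exact pow_lt_one₀ (norm_nonneg _) hz (by simp)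
  have H := hasSum_geometric_of_norm_lt_one hlt
  constructor
  · rw [← Function.Injective.summable_iff inj]
    · have := summable_geometric_of_lt_one (norm_nonneg _) hlt
      refine this.congr fun j => ?_
      simp [kG, pow_mul]
    · intro m hm
      have : ¬ (i+1) ∣ m := fun ⟨c, hc⟩ => hm ⟨c, hc.symm⟩
      simp [kG, this]
  · rw [← Function.Injective.hasSum_iff inj]
    · have e : (fun m => ((kG i).coeff m : ℂ) * z ^ m) ∘ (fun j : ℕ => (i+1) * j) = fun j => (z ^ (i+1)) ^ j := by
        funext j
        simp [kG, pow_mul]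
      rw [e]; exact H
    · intro m hm
      have : ¬ (i+1) ∣ m := fun ⟨c, hc⟩ => hm ⟨c, hc.symm⟩
      simp [kG, this]

lemma kP_hasSum (N : ℕ) (z : ℂ) (hz : ‖z‖ < 1) :
    Summable (fun m => ‖((kP N).coeff m : ℂ) * z ^ m‖) ∧
    HasSum (fun m => ((kP N).coeff m : ℂ) * z ^ m) (∏ i ∈ Finset.range N, (1 - z ^ (i+1))⁻¹) := by
  induction N with
  | zero =>
    have h0 : ∀ m, m ≠ 0 → ((kP 0).coeff m : ℂ) * z ^ m = 0 := by
      intro m hm; simp [kP, PowerSeries.coeff_one, hm]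
    constructor
    · exact summable_of_ne_finset_zero (s := {0}) (fun m hm => by rw [h0 m (by simpa using hm)]; simp)
    · convert hasSum_single 0 h0 using 1
      simp [kP]
  | succ N ih =>
    obtain ⟨a1, a2⟩ := ih
    obtain ⟨b1, b2⟩ := kG_hasSum N z hz
    have key : ∀ m, ((kP (N+1)).coeff m : ℂ) * z ^ m =
        ∑ kl ∈ Finset.HasAntidiagonal.antidiagonal m, (((kP N).coeff kl.1 : ℂ) * z ^ kl.1) * (((kG N).coeff kl.2 : ℂ) * z ^ kl.2) := by
      intro m
      rw [kP, Finset.prod_range_succ, PowerSeries.coeff_mul]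
      push_cast
      rw [Finset.sum_mul]
      refine Finset.sum_congr rfl fun kl hkl => ?_
      rw [← Finset.HasAntidiagonal.mem_antidiagonal.mp hkl, pow_add, kP]; ring
    have s := summable_norm_sum_mul_antidiagonal_of_summable_norm a1 b1
    refine ⟨by simpa only [key] using s, ?_⟩
    have t := tsum_mul_tsum_eq_tsum_sum_antidiagonal_of_summable_norm a1 b1
    rw [a2.tsum_eq, b2.tsum_eq] at t
    rw [Finset.prod_range_succ, t]
    simp only [key]
    exact s.of_norm.hasSum

lemma factor_bound (z : ℂ) (hz : ‖z‖ < 1) :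
    ‖(1 - z)⁻¹‖ ≤ (1 - ‖z‖)⁻¹ * exp (-(‖z‖ - z.re)) := by
  set ρ := ‖z‖ with hρ
  have hρ0 : 0 ≤ ρ := norm_nonneg z
  rcases hρ0.eq_or_lt with h0 | hpos
  · have : z = 0 := by rw [← norm_eq_zero]; exact h0.symm
    subst this; simp at hρ; simp [hρ]
  set d := ρ - z.re with hd
  have hd0 : 0 ≤ d := by have := Complex.re_le_norm z; linarith
  have hd1 : d ≤ 2 * ρ := by have := (abs_le.mp (Complex.abs_re_le_norm z)).1; linarith
  have hn : ‖1 - z‖ ^ 2 = (1-ρ)^2 + 2 * d := by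
    have h1 : ρ ^ 2 = z.re ^2 + z.im ^ 2 := by
      rw [hρ, ← Complex.normSq_eq_norm_sq, Complex.normSq_apply]; ring
    rw [← Complex.normSq_eq_norm_sq, Complex.normSq_apply]
    simp only [Complex.sub_re, Complex.sub_im, Complex.one_re, Complex.one_im]
    nlinarith
  have hE : (1-ρ) * exp (2 * ρ) ≤ 1 + ρ := by
    have h := Real.hasSum_log_sub_log_of_abs_lt_one (x := ρ) (by rw [abs_of_pos hpos]; exact hz)
    have h2 := h.summable.sum_le_tsum {0} (fun i _ => by positivity)
    rw [h.tsum_eq] at h2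
    simp at h2
    rw [← Real.log_div (by linarith) (by linarith), Real.le_log_iff_exp_le (by apply div_pos <;> linarith),
      le_div_iff₀ (by linarith)] at h2
    linarith
  have hconv : exp (2 * d) ≤ 1 + d / (2 * ρ) * (exp (4 * ρ) - 1) := by
    have c := convexOn_exp.2 (Set.mem_univ (0:ℝ)) (Set.mem_univ (4 * ρ))
      (show (0:ℝ) ≤ 1 - d / (2*ρ) by rw [sub_nonneg, div_le_one (by positivity)]; exact hd1) (show 0 ≤ d / (2*ρ) by positivity) (by ring)
    simp only [smul_eq_mul, mul_zero, zero_add, Real.exp_zero, mul_one] at c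
    rw [show d / (2*ρ) * (4 * ρ) = 2 * d by field_simp; ring] at c
    linarith
  have hE2 : (1-ρ)^2 * exp (4 * ρ) ≤ (1+ρ)^2 := by
    rw [show 4 * ρ = 2 * ρ + 2 * ρ by ring, Real.exp_add]
    have : 0 ≤ (1-ρ) * exp (2 * ρ) := mul_nonneg (by linarith) (exp_pos _).le
    nlinarith
  have hmain : ((1-ρ) * exp d)^2 ≤ ‖1 - z‖^2 := by
    rw [hn, mul_pow, ← Real.exp_nat_mul]
    push_cast
    calc (1-ρ)^2 * exp (2 * d) ≤ (1-ρ)^2 * (1 + d / (2 * ρ) * (exp (4 * ρ) - 1)) := by gcongr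
      _ = (1-ρ)^2 + d / (2*ρ) * ((1-ρ)^2 * exp (4 * ρ) - (1-ρ)^2) := by ring
      _ ≤ (1-ρ)^2 + d / (2*ρ) * ((1+ρ)^2 - (1-ρ)^2) := by gcongr
      _ = _ := by field_simp; ring
  have h3 := abs_le_of_sq_le_sq hmain (norm_nonneg _)
  have h4 := (le_abs_self _).trans h3
  rw [norm_inv, Real.exp_neg, ← mul_inv]
  exact inv_anti₀ (mul_pos (by linarith) (exp_pos _)) h4

lemma fourier_bound (N n : ℕ) (r : ℝ) (hr0 : 0 < r) (hr : r < 1) (g : ℝ → ℝ)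
    (hg : Continuous g)
    (hfg : ∀ θ : ℝ, |θ| ≤ π → ‖∏ i ∈ Finset.range N, (1 - ((r : ℂ) * Complex.exp (θ * Complex.I)) ^ (i+1))⁻¹‖ ≤ g θ) :
    ((kP N).coeff n : ℝ) * r ^ n * (2 * π) ≤ ∫ θ in (-π)..π, g θ := by
  have hnorm : ∀ θ : ℝ, ‖(r : ℂ) * Complex.exp (θ * Complex.I)‖ = r := by
    intro θ
    rw [norm_mul, Complex.norm_exp_ofReal_mul_I, Complex.norm_real, Real.norm_of_nonneg hr0.le, mul_one]
  have hE : ∀ θ : ℝ, ‖Complex.exp (-(n * θ * Complex.I))‖ = 1 := by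
    intro θ
    have := Complex.norm_exp_ofReal_mul_I (-(n * θ))
    rw [← this]; congr 2; push_cast; ring
  set F : ℕ → ℝ → ℂ := fun m θ => ((kP N).coeff m : ℂ) * ((r : ℂ) * Complex.exp (θ * Complex.I)) ^ m
    * Complex.exp (-(n * θ * Complex.I)) with hF
  set f : ℝ → ℂ := fun θ => (∏ i ∈ Finset.range N, (1 - ((r : ℂ) * Complex.exp (θ * Complex.I)) ^ (i+1))⁻¹)
    * Complex.exp (-(n * θ * Complex.I)) with hf
  have hr' : ‖(r : ℂ)‖ < 1 := by rwa [Complex.norm_real, Real.norm_of_nonneg hr0.le]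
  have H : HasSum (fun m => ∫ θ in (-π)..π, F m θ) (∫ θ in (-π)..π, f θ) := by
    refine intervalIntegral.hasSum_integral_of_dominated_convergence
      (fun m _ => ‖((kP N).coeff m : ℂ) * (r:ℂ) ^ m‖) ?_ ?_ ?_ ?_ ?_
    · intro m
      apply Continuous.aestronglyMeasurable
      simp only [hF]; fun_prop
    · intro m
      refine Filter.Eventually.of_forall fun θ _ => ?_
      simp only [hF]
      rw [norm_mul, hE, mul_one, norm_mul, norm_pow, hnorm, norm_mul, norm_pow, Complex.norm_real, Real.norm_of_nonneg hr0.le]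
    · exact Filter.Eventually.of_forall fun θ _ => (kP_hasSum N r hr').1
    · exact intervalIntegrable_const
    · refine Filter.Eventually.of_forall fun θ _ => ?_
      exact ((kP_hasSum N _ (by rw [hnorm]; exact hr)).2).mul_right _
  have hz : ∀ m, m ≠ n → ∫ θ in (-π)..π, F m θ = 0 := by
    intro m hm
    have hc : ((m : ℂ) - n) * Complex.I ≠ 0 := by
      apply mul_ne_zero _ Complex.I_ne_zero
      rw [sub_ne_zero]; exact_mod_cast hm
    have e : ∀ θ : ℝ, F m θ = (((kP N).coeff m : ℂ) * (r:ℂ) ^ m) * Complex.exp ((((m : ℂ) - n) * Complex.I) * θ) := by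
      intro θ
      simp only [hF]
      rw [mul_pow, ← Complex.exp_nat_mul, ← mul_assoc, mul_assoc _ (Complex.exp _) (Complex.exp _), ← Complex.exp_add]
      congr 2; ring
    simp only [e]
    rw [intervalIntegral.integral_const_mul, integral_exp_mul_complex hc]
    have : Complex.exp (((m : ℂ) - n) * Complex.I * (π : ℝ)) = Complex.exp (((m : ℂ) - n) * Complex.I * ((-π : ℝ) : ℂ)) := by
      rw [Complex.exp_eq_exp_iff_exists_int]
      refine ⟨(m : ℤ) - n, ?_⟩
      push_cast; ring
    rw [this]; simp
  have hn : ∫ θ in (-π)..π, F n θ = (((kP N).coeff n : ℝ) * r ^ n * (2 * π) : ℝ) := by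
    have e : ∀ θ : ℝ, F n θ = ((kP N).coeff n : ℂ) * (r:ℂ) ^ n := by
      intro θ
      simp only [hF]
      rw [mul_pow, ← Complex.exp_nat_mul, ← mul_assoc, mul_assoc _ (Complex.exp _) (Complex.exp _), ← Complex.exp_add]
      rw [show (n : ℂ) * (θ * Complex.I) + -(n * θ * Complex.I) = 0 by ring]; simp
    simp only [e]
    rw [intervalIntegral.integral_const]
    rw [Complex.real_smul]; push_cast; ring
  have H2 : ∫ θ in (-π)..π, f θ = (((kP N).coeff n : ℝ) * r ^ n * (2 * π) : ℝ) := by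
    rw [← hn]; exact H.unique (hasSum_single n hz)
  have H3 : ‖∫ θ in (-π)..π, f θ‖ ≤ ∫ θ in (-π)..π, g θ := by
    refine intervalIntegral.norm_integral_le_of_norm_le (by linarith [pi_pos]) ?_ (hg.intervalIntegrable _ _)
    refine Filter.Eventually.of_forall fun θ hθ => ?_
    simp only [hf]
    rw [norm_mul, hE, mul_one]
    exact hfg θ (abs_le.mpr ⟨hθ.1.le, hθ.2⟩)
  rw [H2, Complex.norm_real] at H3
  exact (le_abs_self _).trans H3

lemma real_bound (N : ℕ) (t : ℝ) (ht : 0 < t) :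
    ∏ i ∈ Finset.range N, (1 - exp (-t) ^ (i+1))⁻¹ ≤ √(t / 2) * exp (π ^ 2 / (6 * t)) := by
  set r := exp (-t) with hr
  have hr0 : 0 < r := exp_pos _
  have hr1 : r < 1 := by rw [hr, Real.exp_lt_one_iff]; linarith
  have hpos : ∀ i : ℕ, 0 < 1 - r ^ (i+1) := fun i => by
    have : r ^ (i+1) < 1 := pow_lt_one₀ hr0.le hr1 (Nat.succ_ne_zero i)
    linarith
  have hlog : HasSum (fun m : ℕ => ∑ i ∈ Finset.range N, (r ^ (i+1)) ^ (m+1) / ((m:ℝ)+1))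
      (∑ i ∈ Finset.range N, -log (1 - r ^ (i+1))) := by
    refine hasSum_sum fun i _ => ?_
    apply hasSum_pow_div_log_of_abs_lt_one
    rw [abs_of_pos (by positivity)]; linarith [hpos i]
  have hz : HasSum (fun m : ℕ => 1 / ((m:ℝ)+1)^2) (π^2/6) := by
    have := (hasSum_nat_add_iff' 1).mpr hasSum_zeta_two
    simpa using this
  set q := exp (-(t/2)) with hq
  have hq0 : 0 < q := exp_pos _
  have hq1 : q < 1 := by rw [hq, Real.exp_lt_one_iff]; linarith
  have hl2 : HasSum (fun m : ℕ => q ^ (m+1) / ((m:ℝ)+1)) (-log (1 - q)) :=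
    hasSum_pow_div_log_of_abs_lt_one (by rwa [abs_of_pos hq0])
  have hR := (hz.mul_left (1/t)).sub (hl2.mul_left (1/2))
  have hle := hasSum_le ?_ hlog hR
  · have h1q : 1 - q ≤ t / 2 := by have := Real.add_one_le_exp (-(t/2)); linarith
    have h2 : log (1 - q) ≤ log (t/2) := Real.log_le_log (by linarith) h1q
    have h3 : ∑ i ∈ Finset.range N, -log (1 - r ^ (i+1)) ≤ π^2/(6*t) + log (t/2) / 2 := by
      have : 1/t * (π^2/6) = π^2/(6*t) := by field_simp
      linarith
    calc ∏ i ∈ Finset.range N, (1 - r ^ (i+1))⁻¹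
        = exp (∑ i ∈ Finset.range N, -log (1 - r ^ (i+1))) := by
          rw [Real.exp_sum]
          refine Finset.prod_congr rfl fun i _ => ?_
          rw [Real.exp_neg, Real.exp_log (hpos i)]
      _ ≤ exp (π^2/(6*t) + log (t/2) / 2) := Real.exp_le_exp.mpr h3
      _ = _ := by
        rw [Real.exp_add, mul_comm, Real.sqrt_eq_rpow, Real.rpow_def_of_pos (by positivity)]
        congr 2; ring
  · intro m
    set u := ((m:ℝ)+1) * t / 2 with hu
    have hm : (0:ℝ) < (m:ℝ)+1 := by positivity
    have hu0 : 0 < u := by positivity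
    have hrm : r ^ (m+1) = exp (-(2*u)) := by
      rw [hr, ← Real.exp_nat_mul]; congr 1; push_cast; rw [hu]; ring
    have hqm : q ^ (m+1) = exp (-u) := by
      rw [hq, ← Real.exp_nat_mul]; congr 1; push_cast; rw [hu]; ring
    have hx1 : exp (-(2*u)) < 1 := by rw [Real.exp_lt_one_iff]; linarith
    have hgeo : ∑ i ∈ Finset.range N, (r ^ (i+1)) ^ (m+1) ≤ exp (-(2*u)) / (1 - exp (-(2*u))) := by
      have e : ∀ i : ℕ, (r ^ (i+1)) ^ (m+1) = exp (-(2*u)) * exp (-(2*u)) ^ i := by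
        intro i; rw [← hrm]; ring
      simp only [e]
      rw [← Finset.mul_sum, div_eq_mul_inv]
      gcongr
      rw [← tsum_geometric_of_lt_one (exp_pos _).le hx1]
      exact (summable_geometric_of_lt_one (exp_pos _).le hx1).sum_le_tsum _ (fun i _ => by positivity)
    have hkey : exp (-(2*u)) / (1 - exp (-(2*u))) ≤ 1 / (2*u) - exp (-u) / 2 := by
      set y := exp (-u) with hy
      have hy0 : 0 < y := exp_pos _
      have e2 : exp (-(2*u)) = y^2 := by rw [hy, ← Real.exp_nat_mul]; congr 1; push_cast; ring
      rw [e2] at hx1 ⊢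
      have hy1 : y < 1 := by nlinarith
      -- e^u = 1 / y
      have hs : u ≤ Real.sinh u := Real.self_le_sinh_iff.mpr hu0.le
      rw [Real.sinh_eq, Real.exp_neg] at hs
      have hE : u + 1 ≤ exp u := Real.add_one_le_exp u
      have hyE : exp u * y = 1 := by rw [hy, ← Real.exp_add]; simp
      have hs' : 2 * u * y ≤ 1 - y^2 := by
        have : (exp u)⁻¹ = y := by rw [hy, Real.exp_neg]
        rw [this] at hs
        have := mul_le_mul_of_nonneg_right hs hy0.le
        nlinarith
      have hE' : (u+1) * y ≤ 1 := by nlinarith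
      rw [div_le_iff₀ (by linarith), div_sub_div _ _ (by positivity) (by norm_num), div_mul_eq_mul_div, le_div_iff₀ (by positivity)]
      nlinarith [mul_nonneg (sub_nonneg.mpr hs') (sub_nonneg.mpr hE'), mul_pos hu0 hy0]
    rw [← Finset.sum_div, div_le_iff₀ hm]
    refine hgeo.trans (hkey.trans (le_of_eq ?_))
    rw [hqm, hu]; field_simp

noncomputable def kD (r θ : ℝ) : ℝ :=
  r * (1 + r) * (1 - cos θ) / ((1 - r) * ((1 - r)^2 + 2 * r * (1 - cos θ)))

lemma prod_bound (N : ℕ) (r θ : ℝ) (hr0 : 0 < r) (hr : r < 1) :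
    ‖∏ i ∈ Finset.range N, (1 - ((r : ℂ) * Complex.exp (θ * Complex.I)) ^ (i+1))⁻¹‖ ≤
      (∏ i ∈ Finset.range N, (1 - r ^ (i+1))⁻¹) * exp (2 * r ^ N / (1 - r)) * exp (- kD r θ) := by
  set z : ℂ := (r : ℂ) * Complex.exp (θ * Complex.I) with hz
  have hnorm : ‖z‖ = r := by
    rw [hz, norm_mul, Complex.norm_exp_ofReal_mul_I, Complex.norm_real, Real.norm_of_nonneg hr0.le, mul_one]
  have hre : z.re = r * cos θ := by
    rw [hz, Complex.re_ofReal_mul, Complex.exp_ofReal_mul_I_re]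
  have him : z.im = r * sin θ := by
    rw [hz, Complex.im_ofReal_mul, Complex.exp_ofReal_mul_I_im]
  have hz1 : z ≠ 1 := by intro h; rw [h] at hnorm; simp at hnorm; linarith
  have hs : 0 < 1 - r := by linarith
  have hw : 0 ≤ 1 - cos θ := by linarith [cos_le_one θ]
  have h1 : ‖∏ i ∈ Finset.range N, (1 - z ^ (i+1))⁻¹‖ ≤
      ∏ i ∈ Finset.range N, ((1 - r ^ (i+1))⁻¹ * exp (-(r ^ (i+1) - (z ^ (i+1)).re))) := by
    rw [norm_prod]
    refine Finset.prod_le_prod (fun _ _ => norm_nonneg _) fun i _ => ?_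
    have := factor_bound (z ^ (i+1)) (by rw [norm_pow, hnorm]; exact pow_lt_one₀ hr0.le hr (Nat.succ_ne_zero i))
    rwa [norm_pow, hnorm] at this
  have hgr : ∑ i ∈ Finset.range N, r ^ (i+1) = 1 / (1 - r) - 1 - r ^ (N+1) / (1 - r) := by
    simp only [pow_succ]
    rw [← Finset.sum_mul, geom_sum_eq hr.ne]
    have : r - 1 ≠ 0 := by linarith
    field_simp; ring
  have hgz : ∑ i ∈ Finset.range N, z ^ (i+1) = (1 - z)⁻¹ - 1 - z ^ (N+1) / (1 - z) := by
    simp only [pow_succ]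
    rw [← Finset.sum_mul, geom_sum_eq hz1]
    have : z - 1 ≠ 0 := sub_ne_zero.mpr hz1
    have : 1 - z ≠ 0 := sub_ne_zero.mpr hz1.symm
    field_simp; ring
  have hq : r ^ (N+1) ≤ r ^ N := pow_le_pow_of_le_one hr0.le hr.le (Nat.le_succ N)
  have htail : -(r ^ N / (1 - r)) ≤ (z ^ (N+1) / (1 - z)).re := by
    have a1 := (abs_le.mp (Complex.abs_re_le_norm (z ^ (N+1) / (1 - z)))).1
    have a2 : ‖z ^ (N+1) / (1 - z)‖ ≤ r ^ N / (1 - r) := by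
      rw [norm_div, norm_pow, hnorm]
      have a3 : 1 - r ≤ ‖1 - z‖ := by
        have := norm_sub_norm_le (1:ℂ) z
        rwa [norm_one, hnorm] at this
      gcongr
    linarith
  have hinv : ((1 - z)⁻¹).re = 1 / (1 - r) - kD r θ := by
    rw [Complex.inv_re, Complex.normSq_apply]
    simp only [Complex.sub_re, Complex.sub_im, Complex.one_re, Complex.one_im, hre, him, kD]
    have e : (1 - r * cos θ) * (1 - r * cos θ) + (0 - r * sin θ) * (0 - r * sin θ) = (1 - r)^2 + 2 * r * (1 - cos θ) := by
      linear_combination r^2 * sin_sq_add_cos_sq θ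
    rw [e]
    have : 0 < (1 - r)^2 + 2 * r * (1 - cos θ) := by positivity
    field_simp; ring
  have hsum : kD r θ - 2 * r ^ N / (1 - r) ≤ ∑ i ∈ Finset.range N, (r ^ (i+1) - (z ^ (i+1)).re) := by
    rw [Finset.sum_sub_distrib, ← Complex.re_sum, hgr, hgz]
    simp only [Complex.sub_re, hinv, Complex.one_re]
    have : r ^ (N+1) / (1 - r) ≤ r ^ N / (1 - r) := by gcongr
    have : 2 * r ^ N / (1 - r) = r ^ N / (1 - r) + r ^ N / (1 - r) := by ring
    linarith
  refine h1.trans ?_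
  rw [Finset.prod_mul_distrib, ← Real.exp_sum, mul_assoc, ← Real.exp_add, Finset.sum_neg_distrib]
  have : 0 ≤ ∏ i ∈ Finset.range N, (1 - r ^ (i+1))⁻¹ := by
    refine Finset.prod_nonneg fun i _ => ?_
    have : r ^ (i+1) < 1 := pow_lt_one₀ hr0.le hr (Nat.succ_ne_zero i)
    exact inv_nonneg.mpr (by linarith)
  refine mul_le_mul_of_nonneg_left (Real.exp_le_exp.mpr ?_) this
  linarith

lemma integral_bound (t : ℝ) (ht : 0 < t) : ∃ g : ℝ → ℝ, Continuous g ∧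
    (∀ θ : ℝ, |θ| ≤ π → exp (- kD (exp (-t)) θ) ≤ g θ) ∧
    ∫ θ in (-π)..π, g θ ≤ (2 * π) * (4.7 * (t * √t)) := by
  set r := exp (-t) with hr
  have hr0 : 0 < r := exp_pos _
  have hr1 : r < 1 := by rw [hr, Real.exp_lt_one_iff]; linarith
  have hs : 0 < 1 - r := by linarith
  have hst : 1 - r ≤ t := by have := Real.add_one_le_exp (-t); linarith
  set T := √t with hT
  have hT0 : 0 < T := Real.sqrt_pos.mpr ht
  have htT : t = T ^ 2 := (Real.sq_sqrt ht.le).symm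
  by_cases hc : 0.36 ≤ t
  · refine ⟨fun _ => 1, continuous_const, fun θ _ => ?_, ?_⟩
    · rw [Real.exp_le_one_iff, neg_nonpos, kD]
      have hw : 0 ≤ 1 - cos θ := by linarith [cos_le_one θ]
      positivity
    · rw [intervalIntegral.integral_const]
      have : (0.6:ℝ) ≤ T := by rw [hT]; apply Real.le_sqrt_of_sq_le; norm_num; linarith
      have h2 : 1 ≤ 4.7 * (t * T) := by nlinarith
      have := pi_pos
      simp only [smul_eq_mul, mul_one]
      nlinarith
  · push Not at hc
    have hr67 : 0.67 ≤ r := by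
      have h := Real.add_one_le_exp (-(t/2))
      have e : r = exp (-(t/2)) ^ 2 := by rw [hr, ← Real.exp_nat_mul]; congr 1; push_cast; ring
      rw [e]; nlinarith
    set b := 0.113 / t ^ 3 with hb
    have hb0 : 0 < b := by positivity
    refine ⟨fun θ => exp (-(0.4175 / t)) + exp (-b * θ ^ 2), by fun_prop, fun θ hθ => ?_, ?_⟩
    · set w := 1 - cos θ with hw
      have hw0 : 0 ≤ w := by linarith [cos_le_one θ]
      have hwθ : 0.2026 * θ ^ 2 ≤ w := by
        have h1 := Real.cos_le_one_sub_mul_cos_sq hθ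
        have h2 : (0.2026:ℝ) ≤ 2 / π ^ 2 := by
          rw [le_div_iff₀ (by positivity)]
          have := Real.pi_lt_d4; nlinarith [pi_pos]
        have := mul_le_mul_of_nonneg_right h2 (sq_nonneg θ)
        linarith
      have hD : kD r θ = r * (1 + r) * w / ((1 - r) * ((1 - r)^2 + 2 * r * w)) := rfl
      rcases le_total ((1-r)^2) (2 * r * w) with h | h
      · have : 0.4175 / t ≤ kD r θ := by
          have hX : 0 < 2 * r * w := lt_of_lt_of_le (by positivity) h
          calc 0.4175 / t ≤ (1.67/4) / (1 - r) := by rw [show (0.4175:ℝ) = 1.67/4 by norm_num]; gcongr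
            _ ≤ ((1 + r)/4) / (1 - r) := by gcongr; linarith
            _ = (1 + r) * (2 * r * w) / 2 / ((1 - r) * (2 * r * w + 2 * r * w)) := by
              have : w ≠ 0 := by rintro h0; rw [h0] at hX; simp at hX
              field_simp; norm_num
            _ = r * (1 + r) * w / ((1 - r) * (2 * r * w + 2 * r * w)) := by ring
            _ ≤ kD r θ := by rw [hD]; gcongr
        have h1 : exp (- kD r θ) ≤ exp (-(0.4175 / t)) := Real.exp_le_exp.mpr (by linarith)
        have := exp_pos (-b * θ ^ 2)
        linarith
      · have : b * θ ^ 2 ≤ kD r θ := by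
          have h67 : 0.67 * (1 + 0.67) ≤ r * (1 + r) := by gcongr
          calc b * θ ^ 2 = (0.113 * θ ^ 2) / t ^ 3 := by rw [hb]; ring
            _ ≤ (0.113 * θ ^ 2) / (1 - r) ^ 3 := by gcongr
            _ ≤ (r * (1 + r) * w / 2) / (1 - r) ^ 3 := by
              gcongr
              have := mul_le_mul h67 hwθ (by positivity) (by positivity)
              nlinarith [sq_nonneg θ]
            _ = r * (1 + r) * w / ((1 - r) * ((1 - r)^2 + (1-r)^2)) := by field_simp; norm_num
            _ ≤ kD r θ := by rw [hD]; gcongr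
        have h1 : exp (- kD r θ) ≤ exp (-b * θ ^ 2) := Real.exp_le_exp.mpr (by linarith)
        have := exp_pos (-(0.4175 / t))
        linarith
    · rw [intervalIntegral.integral_add (continuous_const.intervalIntegrable _ _)
        ((by fun_prop : Continuous fun θ : ℝ => exp (-b * θ ^ 2)).intervalIntegrable _ _),
        intervalIntegral.integral_const]
      have hG : ∫ θ in (-π)..π, exp (-b * θ ^ 2) ≤ √(π / b) := by
        rw [← integral_gaussian b, intervalIntegral.integral_of_le (by linarith [pi_pos])]
        exact MeasureTheory.setIntegral_le_integral (integrable_exp_neg_mul_sq hb0)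
          (Filter.Eventually.of_forall fun θ => (exp_pos _).le)
      have hS : √(π / b) ≤ 5.3 * (t * T) := by
        apply Real.sqrt_le_iff.mpr ⟨by positivity, ?_⟩
        rw [hb, htT]
        have := Real.pi_lt_d4
        have h6 : 0 < T ^ 6 := by positivity
        rw [show π / (0.113 / (T^2)^3) = π / 0.113 * T ^ 6 by field_simp,
          show (5.3 * (T^2 * T))^2 = 5.3^2 * T^6 by ring]
        apply mul_le_mul_of_nonneg_right _ h6.le
        rw [div_le_iff₀ (by norm_num)]; norm_num at *; linarith
      have hA : exp (-(0.4175 / t)) ≤ 3.72 * (t * T) := by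
        rw [Real.exp_neg]
        have hy := Real.quadratic_le_exp_of_nonneg (x := 0.4175 / t) (by positivity)
        rw [inv_le_iff_one_le_mul₀ (exp_pos _)]
        calc (1:ℝ) ≤ 3.72 * (t * T) * (1 + 0.4175 / t + (0.4175 / t)^2/2) := by
              rw [htT, show 3.72 * (T^2 * T) * (1 + 0.4175 / T^2 + (0.4175 / T^2)^2/2) =
                3.72 * (T^4 + 0.4175 * T^2 + 0.4175^2/2) / T by field_simp]
              rw [le_div_iff₀ hT0]
              nlinarith [sq_nonneg (T - 0.32), pow_pos hT0 4]
          _ ≤ _ := by gcongr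
      have hp := Real.pi_gt_d2
      have htT0 : 0 < t * T := by positivity
      simp only [smul_eq_mul]
      nlinarith

theorem kane_partition_bound (n : ℕ) (hn : 1 ≤ n) :
    (Fintype.card (Nat.Partition n) : ℝ) < 5.5 / n * Real.exp (π * Real.sqrt (2 * n / 3)) := by
  have hn0 : (0:ℝ) < n := by exact_mod_cast hn
  set t := π / √(6 * n) with ht
  have hS : 0 < √(6 * (n:ℝ)) := Real.sqrt_pos.mpr (by positivity)
  have hSS : √(6 * (n:ℝ)) ^ 2 = 6 * n := Real.sq_sqrt (by positivity)
  have ht0 : 0 < t := div_pos pi_pos hS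
  set r := exp (-t) with hr
  have hr0 : 0 < r := exp_pos _
  have hr1 : r < 1 := by rw [hr, Real.exp_lt_one_iff]; linarith
  obtain ⟨g, hg, hg1, hg2⟩ := integral_bound t ht0
  set B := √(t / 2) * exp (π ^ 2 / (6 * t)) with hB
  have hev : ∀ᶠ N : ℕ in Filter.atTop, (Fintype.card (Nat.Partition n) : ℝ) * r ^ n * (2 * π) ≤
      B * exp (2 * r ^ N / (1 - r)) * ((2 * π) * (4.7 * (t * √t))) := by
    filter_upwards [kP_coeff n] with N hN
    have h := fourier_bound N n r hr0 hr1 (fun θ => B * exp (2 * r ^ N / (1 - r)) * g θ) (by fun_prop) ?_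
    · rw [hN, intervalIntegral.integral_const_mul] at h
      refine h.trans ?_
      gcongr
    · intro θ hθ
      refine (prod_bound N r θ hr0 hr1).trans ?_
      have h1 := real_bound N t ht0
      have h2 := hg1 θ hθ
      gcongr
  have hlim : Filter.Tendsto (fun N : ℕ => B * exp (2 * r ^ N / (1 - r)) * ((2 * π) * (4.7 * (t * √t))))
      Filter.atTop (nhds (B * exp (2 * 0 / (1 - r)) * ((2 * π) * (4.7 * (t * √t))))) := by
    have h0 := tendsto_pow_atTop_nhds_zero_of_lt_one hr0.le hr1
    have h1 := (Real.continuous_exp.tendsto _).comp ((h0.const_mul 2).div_const (1 - r))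
    exact (h1.const_mul B).mul_const _
  have hle := ge_of_tendsto hlim hev
  rw [mul_zero, zero_div, Real.exp_zero, mul_one] at hle
  have hle2 : (Fintype.card (Nat.Partition n) : ℝ) * r ^ n ≤ B * (4.7 * (t * √t)) := by
    have h2 : 0 < 2 * π := by positivity
    rw [show B * (2 * π * (4.7 * (t * √t))) = B * (4.7 * (t * √t)) * (2 * π) by ring] at hle
    exact le_of_mul_le_mul_right hle h2
  have hrn : r ^ n = (exp (n * t))⁻¹ := by
    rw [hr, ← Real.exp_nat_mul, ← Real.exp_neg]; congr 1; ring
  rw [hrn, ← div_eq_mul_inv, div_le_iff₀ (exp_pos _)] at hle2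
  have hexp : π * √(2 * n / 3) = π ^ 2 / (6 * t) + n * t := by
    have e : √(2 * (n:ℝ) / 3) = √(6 * n) / 3 := by
      rw [show 2 * (n:ℝ) / 3 = (6 * n) / 3 ^ 2 by ring, Real.sqrt_div (by positivity), Real.sqrt_sq (by norm_num)]
    rw [e, ht]
    field_simp
    nlinarith
  have ht2 : t ^ 2 = π ^ 2 / (6 * n) := by rw [ht, div_pow, hSS]
  have hst : √(t / 2) * √t = t / √2 := by
    rw [Real.sqrt_div ht0.le, div_mul_eq_mul_div, Real.mul_self_sqrt ht0.le]
  have hs2 : (1.414:ℝ) ≤ √2 := Real.le_sqrt_of_sq_le (by norm_num)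
  refine hle2.trans_lt ?_
  rw [hexp, Real.exp_add, hB, ← mul_assoc (5.5 / (n:ℝ))]
  rw [show √(t / 2) * exp (π ^ 2 / (6 * t)) * (4.7 * (t * √t)) * exp (n * t) =
    4.7 * t * (√(t / 2) * √t) * exp (π ^ 2 / (6 * t)) * exp (n * t) by ring, hst]
  gcongr
  rw [show 4.7 * t * (t / √2) = 4.7 * t ^ 2 / √2 by ring, ht2,
    div_lt_iff₀ (by positivity), show 5.5 / (n:ℝ) * √2 = (5.5 * √2) / n by ring, lt_div_iff₀ hn0,
    show 4.7 * (π ^ 2 / (6 * (n:ℝ))) * n = 4.7 * π ^ 2 / 6 by field_simp]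
  have := Real.pi_lt_d4
  nlinarith [pi_pos]
end

section
/- The series Σ_{n≥2} (p(n) − p(n−1)) e^{-πn√3} converges and its value is strictly less than 1/4. -/
open Real

/-- The partition function `p(n)`. -/
def partitionFn (n : ℕ) : ℕ := Fintype.card (Nat.Partition n)

theorem partitionFn_succ_le (n : ℕ) : partitionFn (n + 1) ≤ 2 ^ n := by
  have h := Fintype.card_le_of_surjective _ (Nat.Partition.ofComposition_surj (n := n + 1))
  rw [composition_card] at h
  simpa [partitionFn] using h

theorem exp_term_le (n : ℕ) :
    Real.exp (-(π * (n + 2) * Real.sqrt 3)) ≤ (1 / 32 : ℝ) ^ (n + 2) := by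
  have hs : (5 / 3 : ℝ) ≤ Real.sqrt 3 := Real.le_sqrt_of_sq_le (by norm_num)
  have hp : (3 : ℝ) ≤ π := Real.pi_gt_three.le
  have h5 : (5 : ℝ) ≤ π * Real.sqrt 3 := by nlinarith
  have he : (2 : ℝ) ≤ Real.exp 1 := by
    have := Real.add_one_le_exp (1 : ℝ)
    linarith
  have h32 : (32 : ℝ) ≤ Real.exp (π * Real.sqrt 3) := by
    calc (32 : ℝ) = 2 ^ 5 := by norm_num
      _ ≤ Real.exp 1 ^ 5 := by gcongr
      _ = Real.exp 5 := by rw [← Real.exp_nat_mul]; norm_num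
      _ ≤ _ := Real.exp_le_exp.2 h5
  have e : Real.exp (-(π * (n + 2) * Real.sqrt 3)) = (1 / Real.exp (π * Real.sqrt 3)) ^ (n + 2) := by
    rw [one_div, ← Real.exp_neg, ← Real.exp_nat_mul]
    congr 1
    push_cast
    ring
  rw [e]
  gcongr

theorem partition_diff_series_lt_quarter :
    Summable (fun n : ℕ =>
      ((partitionFn (n + 2) : ℝ) - partitionFn (n + 1)) * Real.exp (-(π * (n + 2) * Real.sqrt 3))) ∧
    (∑' n : ℕ,
      ((partitionFn (n + 2) : ℝ) - partitionFn (n + 1)) * Real.exp (-(π * (n + 2) * Real.sqrt 3)))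
      < 1 / 4 := by
  have hb : ∀ n : ℕ, ‖((partitionFn (n + 2) : ℝ) - partitionFn (n + 1)) *
      Real.exp (-(π * (n + 2) * Real.sqrt 3))‖ ≤ (1 / 512) * (1 / 16 : ℝ) ^ n := by
    intro n
    have h1 : (partitionFn (n + 2) : ℝ) ≤ 2 ^ (n + 1) := by
      exact_mod_cast partitionFn_succ_le (n + 1)
    have h2 : (partitionFn (n + 1) : ℝ) ≤ 2 ^ n := by
      exact_mod_cast partitionFn_succ_le n
    have h3 : (2 : ℝ) ^ n ≤ 2 ^ (n + 1) := pow_le_pow_right₀ (by norm_num) (by omega)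
    have h4 : |(partitionFn (n + 2) : ℝ) - partitionFn (n + 1)| ≤ 2 ^ (n + 1) := by
      have a := Nat.cast_nonneg (α := ℝ) (partitionFn (n + 2))
      have b := Nat.cast_nonneg (α := ℝ) (partitionFn (n + 1))
      rw [abs_le]
      constructor <;> linarith
    rw [norm_mul, Real.norm_eq_abs, Real.norm_eq_abs, Real.abs_exp]
    calc _ ≤ (2 : ℝ) ^ (n + 1) * (1 / 32 : ℝ) ^ (n + 2) := by
          gcongr
          exact exp_term_le n
      _ = (1 / 512) * (1 / 16 : ℝ) ^ n := by
          rw [show (1 / 16 : ℝ) = 2 * (1 / 32) by norm_num, mul_pow]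
          ring
  have hg : HasSum (fun n : ℕ => (1 / 512) * (1 / 16 : ℝ) ^ n) ((1 / 512) * (1 - 1 / 16)⁻¹) :=
    (hasSum_geometric_of_lt_one (by norm_num) (by norm_num)).mul_left _
  have hsum := Summable.of_norm_bounded hg.summable hb
  refine ⟨hsum, ?_⟩
  have := hsum.tsum_le_tsum (fun n => (le_abs_self _).trans (hb n)) hg.summable
  rw [hg.tsum_eq] at this
  refine this.trans_lt ?_
  norm_num
end

section
/- For all n ≥ 2, p(n) − p(n−1) < (5.5/n)·exp(π√(2n/3)), and consequently Σ_{n≥2}(p(n)−p(n−1))e^{−πn√3} ≤ Σ_{n≥2}(5.5/n)·exp(π√(2n/3) − πn√3) < (2−M)/(2+M) for M = 1.12. -/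
open Real

/-- partitions of `n` without part 1 -/
def noOnes (n : ℕ) : Finset (Nat.Partition n) := Finset.univ.filter (fun p => 1 ∉ p.parts)

lemma partitionFn_le (n : ℕ) (hn : 1 ≤ n) :
    partitionFn n ≤ (noOnes n).card + partitionFn (n - 1) := by
  classical
  have h1 : partitionFn n = (noOnes n).card +
      ((Finset.univ : Finset (Nat.Partition n)).filter (fun p => ¬ (1 ∉ p.parts))).card := by
    unfold noOnes partitionFn
    rw [Finset.card_filter_add_card_filter_not]
    rfl
  rw [h1]
  gcongr
  unfold partitionFn
  rw [← Finset.card_univ]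
  let f : Nat.Partition n → Nat.Partition (n - 1) := fun p =>
    if h : 1 ∈ p.parts then
      ⟨p.parts.erase 1, fun {i} hi => p.parts_pos (Multiset.mem_of_mem_erase hi), by
        have := p.parts_sum
        have h2 := Multiset.sum_erase h
        omega⟩
    else Nat.Partition.indiscrete (n - 1)
  apply Finset.card_le_card_of_injOn f
  · intro p _; simp
  · intro p hp q hq hpq
    have hp' : 1 ∈ p.parts := by simpa using hp
    have hq' : 1 ∈ q.parts := by simpa using hq
    simp only [f, hp', hq', dif_pos] at hpq
    have h3 : p.parts.erase 1 = q.parts.erase 1 := congrArg Nat.Partition.parts hpq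
    ext1
    rw [← Multiset.cons_erase hp', ← Multiset.cons_erase hq', h3]

lemma sup_mem_of_ne (s : Multiset ℕ) (h : s ≠ 0) : s.sup ∈ s := by
  induction s using Multiset.induction with
  | empty => exact absurd rfl h
  | cons a s ih =>
    rw [Multiset.sup_cons]
    by_cases hs : s = 0
    · subst hs; simp
    · rcases le_total a s.sup with h1 | h1
      · rw [sup_eq_right.2 h1]; exact Multiset.mem_cons_of_mem (ih hs)
      · rw [sup_eq_left.2 h1]; exact Multiset.mem_cons_self _ _

lemma noOnes_step (n : ℕ) (hn : 1 ≤ n) : (noOnes n).card ≤ (noOnes (n + 1)).card := by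
  classical
  have hne : ∀ p : Nat.Partition n, p.parts ≠ 0 := by
    intro p h
    have := p.parts_sum
    rw [h] at this
    simp at this
    omega
  have hmem : ∀ p : Nat.Partition n, p.parts.sup ∈ p.parts := fun p => sup_mem_of_ne _ (hne p)
  let f : Nat.Partition n → Nat.Partition (n + 1) := fun p =>
    ⟨(p.parts.sup + 1) ::ₘ p.parts.erase p.parts.sup, by
      intro i hi
      rcases Multiset.mem_cons.1 hi with h | h
      · omega
      · exact p.parts_pos (Multiset.mem_of_mem_erase h), by
      have := p.parts_sum
      have h2 := Multiset.sum_erase (hmem p)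
      rw [Multiset.sum_cons]
      omega⟩
  have hsup : ∀ p : Nat.Partition n, (f p).parts.sup = p.parts.sup + 1 := by
    intro p
    show ((p.parts.sup + 1) ::ₘ p.parts.erase p.parts.sup).sup = _
    rw [Multiset.sup_cons, sup_eq_left]
    exact (Multiset.sup_mono (Multiset.erase_subset _ _)).trans (Nat.le_succ _)
  apply Finset.card_le_card_of_injOn f
  · intro p hp
    have hp' : 1 ∉ p.parts := by simpa [noOnes] using hp
    have h0 := p.parts_pos (hmem p)
    have : 1 ∉ (f p).parts := by
      intro h
      rcases Multiset.mem_cons.1 h with h | h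
      · omega
      · exact hp' (Multiset.mem_of_mem_erase h)
    simpa [noOnes] using this
  · intro p _ q _ hpq
    have h1 : p.parts.sup = q.parts.sup := by
      have := hsup p
      rw [hpq, hsup q] at this
      omega
    have h2 : (p.parts.sup + 1) ::ₘ p.parts.erase p.parts.sup =
      (q.parts.sup + 1) ::ₘ q.parts.erase q.parts.sup := congrArg Nat.Partition.parts hpq
    ext1
    rw [← Multiset.cons_erase (hmem p), ← Multiset.cons_erase (hmem q)]
    rw [h1] at h2 ⊢
    rw [(Multiset.cons_inj_right _).1 h2]

lemma noOnes_mono (n j : ℕ) (hn : 1 ≤ n) : (noOnes n).card ≤ (noOnes (n + j)).card := by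
  induction j with
  | zero => simp
  | succ j ih => exact ih.trans (noOnes_step (n + j) (by omega))

lemma sum_noOnes_le (x : ℝ) (hx : 0 < x) (K : ℕ) :
    ∑ k ∈ Finset.range (K + 1), ((noOnes k).card : ℝ) * x ^ k ≤
      ∏ i ∈ Finset.Icc 2 K, ∑ j ∈ Finset.range (K + 1), x ^ (i * j) := by
  classical
  rw [Finset.prod_sum]
  have hparts : ∀ k ∈ Finset.range (K + 1), ∀ p ∈ noOnes k,
      p.parts.toFinset ⊆ Finset.Icc 2 K := by
    intro k hk p hp i hi
    have hi' : i ∈ p.parts := by simpa using hi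
    have hp' : 1 ∉ p.parts := by simpa [noOnes] using hp
    have h0 := p.parts_pos hi'
    have h1 : i ≠ 1 := fun h => hp' (h ▸ hi')
    have h2 := Multiset.le_sum_of_mem hi'
    rw [p.parts_sum] at h2
    simp at hk ⊢
    omega
  have h1 : ∀ k ∈ Finset.range (K + 1), ((noOnes k).card : ℝ) * x ^ k =
      ∑ p ∈ noOnes k, x ^ k := by
    intro k _; simp
  rw [Finset.sum_congr rfl h1, Finset.sum_sigma']
  let F : (Σ k : ℕ, Nat.Partition k) → (∀ i ∈ Finset.Icc 2 K, ℕ) :=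
    fun q i _ => q.2.parts.count i
  have hinj : Set.InjOn F ((Finset.range (K + 1)).sigma noOnes) := by
    rintro ⟨k, p⟩ hp ⟨l, q⟩ hq h
    simp only [Finset.coe_sigma, Set.mem_sigma_iff, Finset.mem_coe] at hp hq
    have hpq : p.parts = q.parts := by
      ext i
      by_cases hi : i ∈ Finset.Icc 2 K
      · exact congrFun (congrFun h i) hi
      · rw [Multiset.count_eq_zero_of_notMem, Multiset.count_eq_zero_of_notMem]
        · intro h'; exact hi (hparts l hq.1 q hq.2 (by simpa using h'))
        · intro h'; exact hi (hparts k hp.1 p hp.2 (by simpa using h'))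
    have hkl : k = l := by rw [← p.parts_sum, ← q.parts_sum, hpq]
    subst hkl
    congr 1
    ext1
    exact hpq
  have h2 : ∀ q ∈ (Finset.range (K + 1)).sigma noOnes, x ^ q.1 =
      ∏ i ∈ (Finset.Icc 2 K).attach, x ^ (i.1 * F q i.1 i.2) := by
    rintro ⟨k, p⟩ hq
    rw [Finset.mem_sigma] at hq
    show x ^ k = ∏ i ∈ (Finset.Icc 2 K).attach, x ^ (i.1 * p.parts.count i.1)
    rw [Finset.prod_attach (Finset.Icc 2 K) (fun i => x ^ (i * p.parts.count i)),
      Finset.prod_pow_eq_pow_sum]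
    congr 1
    have := Finset.sum_multiset_count_of_subset p.parts _ (hparts k hq.1 p hq.2)
    rw [p.parts_sum] at this
    refine this.trans ?_
    exact Finset.sum_congr rfl (fun i _ => by simp [mul_comm])
  rw [Finset.sum_congr rfl h2, ← Finset.sum_image (s := (Finset.range (K + 1)).sigma noOnes)
    (g := F) (f := fun q => ∏ i ∈ (Finset.Icc 2 K).attach, x ^ (i.1 * q i.1 i.2)) hinj]
  apply Finset.sum_le_sum_of_subset_of_nonneg
  · intro g hg
    obtain ⟨⟨k, p⟩, hq, rfl⟩ := Finset.mem_image.1 hg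
    rw [Finset.mem_sigma] at hq
    rw [Finset.mem_pi]
    intro i hi
    show p.parts.count i ∈ _
    have := Finset.sum_multiset_count_of_subset p.parts _ (hparts k hq.1 p hq.2)
    rw [p.parts_sum] at this
    have h3 := Finset.single_le_sum (f := fun m => p.parts.count m • m)
      (fun m _ => Nat.zero_le _) hi
    simp only [smul_eq_mul] at this h3
    have hk := hq.1
    simp at hk hi ⊢
    nlinarith [hi.1]
  · intros; positivity

lemma prod_le (s : ℝ) (hs : 0 < s) (K : ℕ) :
    ∏ i ∈ Finset.Icc 1 K, (1 - exp (-s) ^ i)⁻¹ ≤ exp (π ^ 2 / 6 / s) := by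
  set x := exp (-s) with hxd
  have hx0 : 0 < x := exp_pos _
  have hx1 : x < 1 := by rw [hxd, exp_lt_one_iff]; linarith
  have hxi : ∀ i ∈ Finset.Icc 1 K, x ^ i < 1 := fun i hi =>
    pow_lt_one₀ hx0.le hx1 (by simp at hi; omega)
  have hpos : ∀ i ∈ Finset.Icc 1 K, 0 < (1 - x ^ i)⁻¹ := fun i hi =>
    inv_pos.2 (by linarith [hxi i hi])
  rw [← Real.log_le_iff_le_exp (Finset.prod_pos hpos),
    Real.log_prod (fun i hi => (hpos i hi).ne')]
  have h1 : HasSum (fun m : ℕ => ∑ i ∈ Finset.Icc 1 K, (x ^ i) ^ (m + 1) / ((m : ℝ) + 1))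
      (∑ i ∈ Finset.Icc 1 K, Real.log ((1 - x ^ i)⁻¹)) := by
    apply hasSum_sum
    intro i hi
    rw [Real.log_inv]
    apply Real.hasSum_pow_div_log_of_abs_lt_one
    rw [abs_of_pos (by positivity)]
    exact hxi i hi
  have h2 : HasSum (fun m : ℕ => (1 / ((m + 1 : ℕ) : ℝ) ^ 2) / s) (π ^ 2 / 6 / s) := by
    have := hasSum_zeta_two
    rw [← hasSum_nat_add_iff' 1] at this
    simpa using this.div_const s
  refine hasSum_le (fun m => ?_) h1 h2
  rw [← Finset.sum_div]
  have hm : (0 : ℝ) < (m : ℝ) + 1 := by positivity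
  have h3 : ∑ i ∈ Finset.Icc 1 K, (x ^ i) ^ (m + 1) ≤ 1 / (((m : ℝ) + 1) * s) := by
    set y := x ^ (m + 1) with hy
    have hy0 : 0 < y := by positivity
    have hy1 : y < 1 := pow_lt_one₀ hx0.le hx1 (by omega)
    have e1 : ∑ i ∈ Finset.Icc 1 K, (x ^ i) ^ (m + 1) = y * ∑ i ∈ Finset.range K, y ^ i := by
      clear hxi hpos h1
      induction K with
      | zero => simp
      | succ K ih =>
        rw [Finset.sum_Icc_succ_top (by omega), ih, Finset.sum_range_succ, mul_add, ← pow_succ',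
          hy, ← pow_mul, ← pow_mul, mul_comm (K + 1)]
    have e2 : ∑ i ∈ Finset.range K, y ^ i ≤ (1 - y)⁻¹ := by
      rw [← tsum_geometric_of_lt_one hy0.le hy1]
      exact (summable_geometric_of_lt_one hy0.le hy1).sum_le_tsum _ (fun i _ => by positivity)
    have e3 : y * exp (((m : ℝ) + 1) * s) = 1 := by
      rw [hy, hxd, ← Real.exp_nat_mul, ← Real.exp_add]
      push_cast
      rw [show ((m : ℝ) + 1) * -s + (m + 1) * s = 0 by ring, Real.exp_zero]
    have e4 := Real.add_one_le_exp (((m : ℝ) + 1) * s)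
    have e5 : y * (((m : ℝ) + 1) * s) ≤ 1 - y := by nlinarith
    rw [e1]
    refine (mul_le_mul_of_nonneg_left e2 hy0.le).trans ?_
    rw [← div_eq_mul_inv, div_le_div_iff₀ (by linarith) (by positivity)]
    linarith
  calc _ ≤ 1 / (((m : ℝ) + 1) * s) / ((m : ℝ) + 1) := by gcongr
    _ = _ := by push_cast; field_simp

lemma noOnes_bound (n : ℕ) (hn : 1 ≤ n) (s : ℝ) (hs : 0 < s) :
    ((noOnes n).card : ℝ) ≤ s ^ 2 * exp (π ^ 2 / 6 / s + n * s) := by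
  set x := exp (-s) with hxd
  have hx0 : 0 < x := exp_pos _
  have hx1 : x < 1 := by rw [hxd, exp_lt_one_iff]; linarith
  set E := exp (π ^ 2 / 6 / s) with hE
  have hE0 : 0 < E := exp_pos _
  have key : ∀ J : ℕ, ((noOnes n).card : ℝ) * x ^ n * ∑ j ∈ Finset.range J, x ^ j ≤
      (1 - x) * E := by
    intro J
    have a1 : ((noOnes n).card : ℝ) * x ^ n * ∑ j ∈ Finset.range J, x ^ j ≤
        ∑ k ∈ Finset.range (n + J + 1), ((noOnes k).card : ℝ) * x ^ k := by
      rw [Finset.sum_range_succ, Finset.sum_range_add, Finset.mul_sum]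
      have b1 : ∑ j ∈ Finset.range J, ((noOnes n).card : ℝ) * x ^ n * x ^ j ≤
          ∑ j ∈ Finset.range J, ((noOnes (n + j)).card : ℝ) * x ^ (n + j) := by
        apply Finset.sum_le_sum
        intro j _
        rw [pow_add, mul_assoc]
        exact mul_le_mul_of_nonneg_right (Nat.cast_le.2 (noOnes_mono n j hn))
          (mul_nonneg (pow_nonneg hx0.le _) (pow_nonneg hx0.le _))
      have b2 : 0 ≤ ∑ k ∈ Finset.range n, ((noOnes k).card : ℝ) * x ^ k :=
        Finset.sum_nonneg (fun k _ => mul_nonneg (Nat.cast_nonneg _) (pow_nonneg hx0.le _))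
      have b3 : 0 ≤ ((noOnes (n + J)).card : ℝ) * x ^ (n + J) :=
        mul_nonneg (Nat.cast_nonneg _) (pow_nonneg hx0.le _)
      linarith
    refine a1.trans ((sum_noOnes_le x hx0 (n + J)).trans ?_)
    have a2 : ∏ i ∈ Finset.Icc 2 (n + J), ∑ j ∈ Finset.range (n + J + 1), x ^ (i * j) ≤
        ∏ i ∈ Finset.Icc 2 (n + J), (1 - x ^ i)⁻¹ := by
      apply Finset.prod_le_prod
      · intros; positivity
      · intro i hi
        have hi1 : x ^ i < 1 := pow_lt_one₀ hx0.le hx1 (by simp at hi; omega)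
        have hi0 : 0 ≤ x ^ i := by positivity
        simp only [pow_mul]
        rw [← tsum_geometric_of_lt_one hi0 hi1]
        exact (summable_geometric_of_lt_one hi0 hi1).sum_le_tsum _ (fun i _ => by positivity)
    refine a2.trans ?_
    have a3 := prod_le s hs (n + J)
    rw [← hxd, ← Finset.insert_Icc_add_one_left_eq_Icc (show 1 ≤ n + J by omega),
      Finset.prod_insert (by simp), pow_one] at a3
    have h1x : 0 < 1 - x := by linarith
    rw [inv_mul_le_iff₀ h1x] at a3
    exact a3
  have h1x : 0 < 1 - x := by linarith
  have lim : ((noOnes n).card : ℝ) * x ^ n * (1 - x)⁻¹ ≤ (1 - x) * E :=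
    le_of_tendsto' ((hasSum_geometric_of_lt_one hx0.le hx1).tendsto_sum_nat.const_mul _) key
  rw [← div_eq_mul_inv, div_le_iff₀ h1x] at lim
  have hxs : 1 - x ≤ s := by linarith [Real.add_one_le_exp (-s)]
  have hxn : x ^ n * exp (n * s) = 1 := by
    rw [hxd, ← Real.exp_nat_mul, ← Real.exp_add]
    rw [show (n : ℝ) * -s + n * s = 0 by ring, Real.exp_zero]
  calc ((noOnes n).card : ℝ) = ((noOnes n).card : ℝ) * x ^ n * exp (n * s) := by
        rw [mul_assoc, hxn, mul_one]
    _ ≤ ((1 - x) * E * (1 - x)) * exp (n * s) :=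
        mul_le_mul_of_nonneg_right lim (Real.exp_pos _).le
    _ ≤ (s * E * s) * exp (n * s) := by gcongr
    _ = _ := by rw [Real.exp_add]; ring

lemma diff_bound (n : ℕ) (hn : 2 ≤ n) :
    (partitionFn n : ℝ) - partitionFn (n - 1) <
      5.5 / n * Real.exp (π * Real.sqrt (2 * n / 3)) := by
  have h1 : (partitionFn n : ℝ) ≤ (noOnes n).card + partitionFn (n - 1) := by
    exact_mod_cast partitionFn_le n (by omega)
  have hn0 : (0 : ℝ) < n := by positivity
  set r := Real.sqrt (2 * n / 3) with hr
  have hr0 : 0 < r := Real.sqrt_pos.2 (by positivity)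
  have hr2 : r ^ 2 = 2 * n / 3 := Real.sq_sqrt (by positivity)
  have hpi := Real.pi_pos
  have h2 := noOnes_bound n (by omega) (π / (3 * r)) (by positivity)
  have e1 : π ^ 2 / 6 / (π / (3 * r)) + n * (π / (3 * r)) = π * r := by
    have : (n : ℝ) = 3 / 2 * r ^ 2 := by rw [hr2]; ring
    rw [this]
    field_simp
    ring
  have e2 : (π / (3 * r)) ^ 2 = π ^ 2 / 6 / n := by
    rw [div_pow, mul_pow, hr2]
    field_simp
    ring
  rw [e1, e2] at h2
  have h3 : π ^ 2 / 6 / n < 5.5 / n := by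
    apply div_lt_div_of_pos_right _ hn0
    nlinarith [Real.pi_lt_four]
  have h4 := mul_lt_mul_of_pos_right h3 (Real.exp_pos (π * r))
  linarith

lemma term_bound (n : ℕ) : 5.5 / (n + 2 : ℝ) *
        Real.exp (π * Real.sqrt (2 * (n + 2) / 3) - π * (n + 2) * Real.sqrt 3) ≤
      2.75 / 64 * (1 / 8 : ℝ) ^ n := by
  have hn0 : (0 : ℝ) ≤ n := by positivity
  have hpi := Real.pi_gt_three
  have h3 : (1.7 : ℝ) ≤ Real.sqrt 3 := Real.le_sqrt_of_sq_le (by norm_num)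
  have hs : Real.sqrt (2 * (n + 2) / 3) ≤ 0.6 * (n + 2) :=
    Real.sqrt_le_iff.2 ⟨by positivity, by nlinarith⟩
  have e1 : π * Real.sqrt (2 * (n + 2) / 3) - π * (n + 2) * Real.sqrt 3 ≤
      ((n + 2 : ℕ) : ℝ) * (-3) := by
    push_cast
    have a : Real.sqrt (2 * (n + 2) / 3) - (n + 2) * Real.sqrt 3 ≤ -(n + 2) := by nlinarith
    nlinarith
  have e2 : exp (-3 : ℝ) ≤ 1 / 8 := by
    have : (8 : ℝ) ≤ exp 3 := by
      have h1 := Real.add_one_le_exp (1 : ℝ)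
      have : exp 3 = exp 1 ^ 3 := by rw [← Real.exp_nat_mul]; norm_num
      rw [this]
      calc (8 : ℝ) = 2 ^ 3 := by norm_num
        _ ≤ _ := by gcongr; linarith
    rw [Real.exp_neg, ← one_div]
    exact one_div_le_one_div_of_le (by norm_num) this
  calc _ ≤ 5.5 / 2 * exp (((n + 2 : ℕ) : ℝ) * (-3)) := by
        gcongr
        linarith
    _ = 5.5 / 2 * exp (-3) ^ (n + 2) := by rw [Real.exp_nat_mul]
    _ ≤ 5.5 / 2 * (1 / 8) ^ (n + 2) := by gcongr
    _ = _ := by rw [pow_add]; ring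

theorem partition_diff_series_bound :
    (∀ n : ℕ, 2 ≤ n →
      (partitionFn n : ℝ) - partitionFn (n - 1) < 5.5 / n * Real.exp (π * Real.sqrt (2 * n / 3))) ∧
    (∑' n : ℕ, ((partitionFn (n + 2) : ℝ) - partitionFn (n + 1)) *
        Real.exp (-(π * (n + 2) * Real.sqrt 3)))
      ≤ (∑' n : ℕ, 5.5 / (n + 2 : ℝ) *
        Real.exp (π * Real.sqrt (2 * (n + 2) / 3) - π * (n + 2) * Real.sqrt 3)) ∧
    (∑' n : ℕ, 5.5 / (n + 2 : ℝ) *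
        Real.exp (π * Real.sqrt (2 * (n + 2) / 3) - π * (n + 2) * Real.sqrt 3))
      < (2 - 1.12) / (2 + 1.12) := by
  have hg : HasSum (fun n : ℕ => 2.75 / 64 * (1 / 8 : ℝ) ^ n) (2.75 / 64 * (1 - 1 / 8)⁻¹) :=
    (hasSum_geometric_of_lt_one (by norm_num) (by norm_num)).mul_left _
  have hsum : Summable (fun n : ℕ => 5.5 / (n + 2 : ℝ) *
        Real.exp (π * Real.sqrt (2 * (n + 2) / 3) - π * (n + 2) * Real.sqrt 3)) :=
    Summable.of_nonneg_of_le (fun n => by positivity) term_bound hg.summable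
  refine ⟨diff_bound, ?_, ?_⟩
  · by_cases hL : Summable (fun n : ℕ => ((partitionFn (n + 2) : ℝ) - partitionFn (n + 1)) *
        Real.exp (-(π * (n + 2) * Real.sqrt 3)))
    · refine hL.tsum_le_tsum (fun n => ?_) hsum
      have h := diff_bound (n + 2) (by omega)
      rw [show n + 2 - 1 = n + 1 by omega] at h
      push_cast at h
      rw [sub_eq_add_neg (π * Real.sqrt (2 * (n + 2) / 3)), Real.exp_add, ← mul_assoc]
      exact mul_le_mul_of_nonneg_right h.le (Real.exp_pos _).le
    · rw [tsum_eq_zero_of_not_summable hL]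
      exact tsum_nonneg (fun n => by positivity)
  · refine (hsum.tsum_le_tsum term_bound hg.summable).trans_lt ?_
    rw [hg.tsum_eq]
    norm_num
end
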